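/- arXiv:1903.08351 — 2 statements merged into one kernel-verified Lean document; each statement's English description precedes it below -/
import Mathlib

section
/- Let d : U → U → ℝ be a metric distance on a finite set U, g a non-negative monotone submodular set function on U, D the sum-sum diversity of d, and f = g + D. Let k ≥ 10 and let x_1,…,x_k be a greedy sequence for f on T ⊆ U with S_k = {x_1,…,x_k}. Then for every t ∈ T ∖ S_k: f(S_k ∪ {t}) − f(S_k) ≤ (5/k)·f(S_k); that is, the greedy algorithm is a 5-nice algorithm for f. -/
open Finset

/-- Sum-sum diversity: the sum of `d u v` over all unordered pairs of distinct
elements of `S` (each unordered pair counted once). -/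
noncomputable def sumsumDiv {α : Type*} [DecidableEq α] (d : α → α → ℝ) (S : Finset α) : ℝ :=
  (∑ p ∈ S.offDiag, d p.1 p.2) / 2

/-- The prefix set `{x 0, …, x (i-1)}` of a sequence `x`. -/
def preSet {α : Type*} [DecidableEq α] {k : ℕ} (x : Fin k → α) (i : ℕ) : Finset α :=
  (Finset.univ.filter fun j : Fin k => (j : ℕ) < i).image x

/-- `x 0, …, x (k-1)` is a greedy sequence for `f = g + D` on `T`: its members are
distinct elements of `T` and each one maximizes the marginal gain
`Δ(u, S_{i-1}) + ∑_{j < i} d (x j) u` over all `u ∈ T ∖ S_{i-1}`. -/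
def IsGreedySeq {α : Type*} [DecidableEq α] (g : Finset α → ℝ) (d : α → α → ℝ)
    (T : Finset α) {k : ℕ} (x : Fin k → α) : Prop :=
  Function.Injective x ∧ (∀ j, x j ∈ T) ∧
    ∀ i : Fin k, ∀ u ∈ T \ preSet x (i : ℕ),
      (g (insert u (preSet x (i : ℕ))) - g (preSet x (i : ℕ)))
          + ∑ j ∈ Finset.univ.filter (fun j : Fin k => (j : ℕ) < (i : ℕ)), d (x j) u
        ≤ (g (insert (x i) (preSet x (i : ℕ))) - g (preSet x (i : ℕ)))
          + ∑ j ∈ Finset.univ.filter (fun j : Fin k => (j : ℕ) < (i : ℕ)), d (x j) (x i)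

theorem sum_max_arith_le (s l : ℝ) (hl : 0 < l) (n : ℕ) :
    ∑ j ∈ range n, max 0 (s + l * j) ≤ (max 0 (s + l * n - l / 2)) ^ 2 / (2 * l) := by
  induction n with
  | zero => simp only [range_zero, sum_empty]; positivity
  | succ n ih =>
    rw [sum_range_succ]
    refine (add_le_add_left ih _).trans ?_
    push_cast
    generalize hy : s + l * n = y
    rw [show s + l * ((n : ℝ) + 1) - l / 2 = y + l / 2 by rw [← hy]; ring,
      div_add' _ _ _ (by positivity)]
    refine div_le_div_of_nonneg_right ?_ (by positivity)
    rcases le_total 0 y with h | h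
    · rw [max_eq_right h, max_eq_right (by linarith : 0 ≤ y + l / 2)]
      rcases le_total 0 (y - l / 2) with h' | h'
      · rw [max_eq_right h']; nlinarith
      · rw [max_eq_left h']; nlinarith [sq_nonneg (y - l / 2)]
    · rw [max_eq_left h, max_eq_left (by linarith : y - l / 2 ≤ 0)]
      nlinarith [sq_nonneg (max 0 (y + l / 2))]

theorem sum_range_sum_range_eq (a : ℕ → ℝ) (n : ℕ) :
    ∑ i ∈ range n, ∑ j ∈ range i, a j = ∑ j ∈ range n, ((n : ℝ) - 1 - j) * a j := by
  induction n with
  | zero => simp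
  | succ n ih =>
    rw [sum_range_succ, ih, sum_range_succ, ← sum_add_distrib]
    push_cast
    rw [show ((n : ℝ) + 1 - 1 - n) * a n = 0 by ring, add_zero]
    exact sum_congr rfl fun j _ => by ring

/-- The weight `l = 5 - k / m` with `m = k / 2` balances the demand of late elements
against the surplus of early ones. -/
theorem exists_weight (k : ℕ) (hk : 10 ≤ k) :
    ∃ (m : ℕ) (l : ℝ), 0 < m ∧ m ≤ k ∧ 1 ≤ l ∧ l ≤ 5 ∧ (k : ℝ) = (5 - l) * m ∧
      ((k : ℝ) + l / 2) ^ 2 / (2 * l) ≤ m * (l * (k - m) - k) := by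
  obtain ⟨m, rfl | rfl⟩ := Nat.even_or_odd' k
  · have hm : (5 : ℝ) ≤ m := by exact_mod_cast (by omega : 5 ≤ m)
    refine ⟨m, 3, by omega, by omega, by norm_num, by norm_num, by push_cast; ring, ?_⟩
    rw [div_le_iff₀ (by norm_num)]
    push_cast
    nlinarith
  · have hm : (5 : ℝ) ≤ m := by exact_mod_cast (by omega : 5 ≤ m)
    have hm0 : (0 : ℝ) < m := by linarith
    have hinv : 1 / (m : ℝ) ≤ 1 := by rw [div_le_one hm0]; linarith
    have hinv0 : 0 < 1 / (m : ℝ) := by positivity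
    refine ⟨m, 3 - 1 / m, by omega, by omega, by linarith, by linarith, ?_, ?_⟩
    · push_cast; field_simp; ring
    · rw [div_le_iff₀ (by linarith)]
      push_cast
      have key : (4 * (m : ℝ) ^ 2 + 5 * m - 1) ^ 2
          ≤ 8 * m * (3 * m - 1) * (m ^ 2 + m - 1) := by
        obtain ⟨z, hz⟩ : ∃ z : ℝ, (m : ℝ) = z + 5 := ⟨m - 5, by ring⟩
        have hz0 : 0 ≤ z := by linarith
        rw [hz, ← sub_nonneg]
        ring_nf
        positivity
      have e1 : (2 * (m : ℝ) + 1 + (3 - 1 / m) / 2) ^ 2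
          = (4 * (m : ℝ) ^ 2 + 5 * m - 1) ^ 2 / (4 * m ^ 2) := by
        field_simp; ring
      have e2 : (m : ℝ) * ((3 - 1 / m) * (2 * m + 1 - m) - (2 * m + 1)) * (2 * (3 - 1 / m))
          = (8 * m * (3 * m - 1) * (m ^ 2 + m - 1)) / (4 * m ^ 2) := by
        field_simp; ring
      rw [e1, e2]
      exact div_le_div_of_nonneg_right key (by positivity)

theorem card_mul_sum_le_of_triangle (k : ℕ) (hk : 10 ≤ k) (a : ℕ → ℝ) (e : ℕ → ℕ → ℝ)
    (δ F : ℝ) (ha : ∀ j, 0 ≤ a j) (he : ∀ i j, 0 ≤ e i j) (hδ : 0 ≤ δ)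
    (htri : ∀ i j, a j ≤ a i + e i j)
    (hgain : k * δ + ∑ i ∈ range k, ∑ j ∈ range i, a j ≤ F)
    (hdiv : ∑ i ∈ range k, ∑ j ∈ range i, e j i ≤ F) :
    k * (δ + ∑ j ∈ range k, a j) ≤ 5 * F := by
  obtain ⟨m, l, hm, hmk, hl1, hl5, hkm, hbound⟩ := exists_weight k hk
  have hm0 : (0 : ℝ) < m := by exact_mod_cast hm
  rw [sum_range_sum_range_eq] at hgain
  set c : ℕ → ℝ := fun j => max 0 ((k : ℝ) - l * (k - 1) + l * j) / m with hc
  have hc0 : ∀ j, 0 ≤ c j := fun j => by positivity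
  have hcsum : ∑ j ∈ Ico m k, c j ≤ l * (k - m) - k := by
    calc ∑ j ∈ Ico m k, c j ≤ ∑ j ∈ range k, c j := by
          refine sum_le_sum_of_subset_of_nonneg ?_ fun j _ _ => hc0 j
          intro j hj
          rw [mem_Ico] at hj
          exact mem_range.2 hj.2
      _ ≤ l * (k - m) - k := by
          simp only [hc]
          rw [← sum_div, div_le_iff₀ hm0]
          refine (sum_max_arith_le _ l (by linarith) k).trans ?_
          rw [show (k : ℝ) - l * (k - 1) + l * k - l / 2 = k + l / 2 by ring,
            max_eq_right (by positivity), mul_comm _ (m : ℝ)]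
          exact hbound
  have hlate : ∀ j ∈ Ico m k, k * a j ≤ l * (((k : ℝ) - 1 - j) * a j)
      + c j * ∑ i ∈ range m, a i + (5 - l) * ∑ i ∈ range m, e i j := by
    intro j hj
    rw [mem_Ico] at hj
    have hjk : (j : ℝ) + 1 ≤ k := by exact_mod_cast hj.2
    have hcm : c j * m = max 0 ((k : ℝ) - l * (k - 1) + l * j) := by
      simp only [hc]; field_simp
    have hcle : c j ≤ 5 - l := by
      refine le_of_mul_le_mul_right ?_ hm0
      rw [hcm, ← hkm]
      exact max_le (by positivity) (by nlinarith)
    have h1 : (c j * m) * a j ≤ c j * ∑ i ∈ range m, a i + c j * ∑ i ∈ range m, e i j := by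
      rw [← mul_add, ← sum_add_distrib, mul_assoc]
      refine mul_le_mul_of_nonneg_left ?_ (hc0 j)
      calc (m : ℝ) * a j = ∑ i ∈ range m, a j := by simp
        _ ≤ _ := sum_le_sum fun i _ => htri i j
    have h2 : c j * ∑ i ∈ range m, e i j ≤ (5 - l) * ∑ i ∈ range m, e i j :=
      mul_le_mul_of_nonneg_right hcle (sum_nonneg fun i _ => he i j)
    have h3 : ((k : ℝ) - l * (k - 1) + l * j) * a j ≤ (c j * m) * a j :=
      mul_le_mul_of_nonneg_right (hcm ▸ le_max_right _ _) (ha j)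
    linarith
  have hearly : ∀ i ∈ range m, k * a i + (l * (k - m) - k) * a i
      ≤ l * (((k : ℝ) - 1 - i) * a i) := by
    intro i hi
    have him : (i : ℝ) + 1 ≤ m := by exact_mod_cast mem_range.1 hi
    have := mul_le_mul_of_nonneg_right
      (mul_le_mul_of_nonneg_left (by linarith : (k : ℝ) - m ≤ k - 1 - i) (by linarith : 0 ≤ l))
      (ha i)
    linarith
  have hcross : ∑ j ∈ Ico m k, ∑ i ∈ range m, e i j ≤ F := by
    refine le_trans ?_ hdiv
    calc ∑ j ∈ Ico m k, ∑ i ∈ range m, e i j ≤ ∑ j ∈ Ico m k, ∑ i ∈ range j, e i j :=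
          sum_le_sum fun j hj => sum_le_sum_of_subset_of_nonneg
            (range_subset_range.2 (mem_Ico.1 hj).1) fun i _ _ => he i j
      _ ≤ _ := by
          refine sum_le_sum_of_subset_of_nonneg ?_ fun j _ _ => sum_nonneg fun i _ => he i j
          intro j hj
          exact mem_range.2 (mem_Ico.1 hj).2
  have hL := sum_le_sum hlate
  have hE := sum_le_sum hearly
  rw [sum_add_distrib, sum_add_distrib, ← mul_sum, ← mul_sum, ← sum_mul, ← mul_sum] at hL
  rw [sum_add_distrib, ← mul_sum, ← mul_sum, ← mul_sum] at hE
  rw [← sum_range_add_sum_Ico _ hmk] at hgain ⊢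
  have hA : (∑ j ∈ Ico m k, c j) * ∑ i ∈ range m, a i
      ≤ (l * (k - m) - k) * ∑ i ∈ range m, a i :=
    mul_le_mul_of_nonneg_right hcsum (sum_nonneg fun i _ => ha i)
  have hX := mul_le_mul_of_nonneg_left hcross (by linarith : 0 ≤ 5 - l)
  have hG := mul_le_mul_of_nonneg_left hgain (by linarith : 0 ≤ l)
  have hD : (k : ℝ) * δ ≤ l * (k * δ) := le_mul_of_one_le_left (by positivity) hl1
  linarith

theorem sumsumDiv_insert {α : Type*} [DecidableEq α] (d : α → α → ℝ)
    (hdsymm : ∀ u v, d u v = d v u) (S : Finset α) (t : α) (ht : t ∉ S) :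
    sumsumDiv d (insert t S) = sumsumDiv d S + ∑ u ∈ S, d u t := by
  have hne : ∀ u ∈ S, u ≠ t := fun u hu h => ht (h ▸ hu)
  have h1 : Disjoint S.offDiag ({t} ×ˢ S) := by
    rw [disjoint_left]
    rintro ⟨p, q⟩ hp hq
    simp only [mem_offDiag, mem_product, mem_singleton] at hp hq
    exact hne p hp.1 hq.1
  have h2 : Disjoint (S.offDiag ∪ {t} ×ˢ S) (S ×ˢ {t}) := by
    rw [disjoint_left]
    rintro ⟨p, q⟩ hp hq
    simp only [mem_union, mem_offDiag, mem_product, mem_singleton] at hp hq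
    rcases hp with hp | hp
    · exact hne q hp.2.1 hq.2
    · exact hne q hp.2 hq.2
  unfold sumsumDiv
  rw [offDiag_insert ht, sum_union h2, sum_union h1, sum_product, sum_product]
  simp only [sum_singleton]
  rw [sum_congr rfl fun u _ => hdsymm t u]
  ring

theorem sumsumDiv_image_range {α : Type*} [DecidableEq α] (d : α → α → ℝ)
    (hdsymm : ∀ u v, d u v = d v u) (y : ℕ → α) (n : ℕ)
    (hy : Set.InjOn y (range n : Finset ℕ)) :
    sumsumDiv d ((range n).image y) = ∑ i ∈ range n, ∑ j ∈ range i, d (y j) (y i) := by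
  induction n with
  | zero => simp [sumsumDiv]
  | succ n ih =>
    have hsub : range n ⊆ range (n + 1) := range_subset_range.2 (Nat.le_succ n)
    have hy' : Set.InjOn y (range n : Finset ℕ) := hy.mono (by exact_mod_cast hsub)
    have hn : y n ∉ (range n).image y := by
      intro h
      obtain ⟨j, hj, hjn⟩ := mem_image.1 h
      have := hy (by exact_mod_cast hsub hj) (by simp) hjn
      exact absurd (mem_range.1 hj) (by omega)
    rw [range_add_one, image_insert, sumsumDiv_insert d hdsymm _ _ hn, ih hy',
      sum_image hy', sum_insert notMem_range_self, add_comm]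

/-- 5-niceness of the greedy algorithm: if `k ≥ 10` and `x 1, …, x k` is a
greedy sequence for `f = g + D` on `T ⊆ U` with `S_k = {x 1, …, x k}`, then for every
`t ∈ T ∖ S_k`, `f(S_k ∪ {t}) − f(S_k) ≤ (5/k)·f(S_k)`. -/
theorem stmt6 {α : Type*} [Fintype α] [DecidableEq α]
    (d : α → α → ℝ)
    (hd0 : ∀ u, d u u = 0) (hdnn : ∀ u v, 0 ≤ d u v)
    (hdsymm : ∀ u v, d u v = d v u)
    (hdtri : ∀ u v w, d u w ≤ d u v + d v w)
    (g : Finset α → ℝ)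
    (hgnn : ∀ S : Finset α, 0 ≤ g S)
    (hgmono : ∀ A B : Finset α, A ⊆ B → g A ≤ g B)
    (hgsub : ∀ A B : Finset α, A ⊆ B → ∀ y ∉ B,
      g (insert y B) - g B ≤ g (insert y A) - g A)
    (k : ℕ) (hk : 10 ≤ k) (T : Finset α) (x : Fin k → α) (hx : IsGreedySeq g d T x)
    (t : α) (htT : t ∈ T) (htx : t ∉ Finset.univ.image x) :
    (g (insert t (Finset.univ.image x)) + sumsumDiv d (insert t (Finset.univ.image x)))
        - (g (Finset.univ.image x) + sumsumDiv d (Finset.univ.image x))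
      ≤ 5 / (k : ℝ)
          * (g (Finset.univ.image x) + sumsumDiv d (Finset.univ.image x)) := by
  obtain ⟨hinj, -, hgreedy⟩ := hx
  have hk0 : 0 < k := by omega
  obtain ⟨y, hy⟩ : ∃ y : ℕ → α, ∀ i : Fin k, y i = x i :=
    ⟨fun n => if h : n < k then x ⟨n, h⟩ else t, fun i => by simp⟩
  have hyinj : Set.InjOn y (range k : Finset ℕ) := by
    intro i hi j hj hij
    have hi' : i < k := by simpa using hi
    have hj' : j < k := by simpa using hj
    have := hinj (((hy ⟨i, hi'⟩).symm.trans hij).trans (hy ⟨j, hj'⟩))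
    simpa using this
  have hfilter : ∀ n ≤ k, ∀ F : α → ℝ,
      ∑ j ∈ univ.filter (fun j : Fin k => (j : ℕ) < n), F (x j)
        = ∑ j ∈ range n, F (y j) := by
    intro n hn F
    refine sum_bij (fun j _ => (j : ℕ)) ?_ ?_ ?_ ?_
    · intro j hj; simpa using hj
    · intro i _ j _ h; exact Fin.ext h
    · intro j hj
      have hj' := mem_range.1 hj
      exact ⟨⟨j, by omega⟩, by simpa using hj', rfl⟩
    · intro j _; rw [hy]
  have hpre : ∀ n ≤ k, preSet x n = (range n).image y := by
    intro n hn
    ext u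
    simp only [preSet, mem_image, mem_filter, mem_univ, true_and, mem_range]
    constructor
    · rintro ⟨j, hj, rfl⟩; exact ⟨j, hj, hy j⟩
    · rintro ⟨j, hj, rfl⟩; exact ⟨⟨j, by omega⟩, hj, (hy ⟨j, by omega⟩).symm⟩
  have hfull : univ.image x = (range k).image y := by
    rw [← hpre k le_rfl, preSet, filter_true_of_mem fun j _ => j.2]
  rw [hfull] at htx ⊢
  set S := (range k).image y with hS
  have hstep : ∀ n ∈ range k, (g (insert t S) - g S) + ∑ j ∈ range n, d (y j) t
      ≤ (g ((range (n + 1)).image y) - g ((range n).image y))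
        + ∑ j ∈ range n, d (y j) (y n) := by
    intro n hn
    have hnk := mem_range.1 hn
    have hsub : (range n).image y ⊆ S := image_subset_image (range_subset_range.2 hnk.le)
    have h := hgreedy ⟨n, hnk⟩ t (by
      rw [mem_sdiff, hpre n hnk.le]
      exact ⟨htT, fun h => htx (hsub h)⟩)
    simp only [hpre n hnk.le] at h
    rw [hfilter n hnk.le fun u => d u t, hfilter n hnk.le fun u => d u (x ⟨n, hnk⟩),
      ← hy ⟨n, hnk⟩, ← image_insert, ← range_add_one] at h
    linarith [hgsub _ _ hsub t htx]
  have hsum := sum_le_sum hstep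
  rw [sum_add_distrib, sum_add_distrib, sum_range_sub fun n => g ((range n).image y)] at hsum
  simp only [sum_const, card_range, nsmul_eq_mul, range_zero, image_empty] at hsum
  have hdivS := sumsumDiv_image_range d hdsymm y k hyinj
  rw [← hS] at hsum hdivS
  have hmain := card_mul_sum_le_of_triangle k hk (fun j => d (y j) t)
    (fun i j => d (y i) (y j)) (g (insert t S) - g S) (g S + sumsumDiv d S)
    (fun j => hdnn _ _) (fun i j => hdnn _ _) (by linarith [hgmono S _ (subset_insert t S)])
    (fun i j => by linarith [hdtri (y j) (y i) t, hdsymm (y j) (y i)])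
    (by linarith [hgnn ∅]) (by linarith [hgnn S])
  have hk' : (0 : ℝ) < k := by exact_mod_cast hk0
  rw [sumsumDiv_insert d hdsymm S t htx, hS, sum_image hyinj, ← hS, div_mul_eq_mul_div,
    le_div_iff₀ hk']
  linarith
end

section
/- Let g be a non-negative monotone submodular set function on a finite set U with g(∅) = 0, d a metric distance on U, D the sum-sum diversity of d, f = g + D, and k ≥ 10. Let T¹,…,Tᵐ be a partition of U, and for each i let Sⁱ ⊆ Tⁱ with |Sⁱ| = k satisfy the 5-niceness bound: f(Sⁱ ∪ {x}) − f(Sⁱ) ≤ (5/k)·f(Sⁱ) for every x ∈ Tⁱ ∖ Sⁱ (as holds for the output of the greedy algorithm). Let O = {o_1,…,o_k} be a k-subset of U maximizing f over k-subsets of U, with prefix sets O_x = {o_1,…,o_{j−1}} for x = o_j, and let OPT(∪_i Sⁱ) be a k-subset of ∪_{i=1}^m Sⁱ maximizing f. Then g(O) ≤ 6·f(OPT(∪_{i=1}^m Sⁱ)) + Σ_{i=1}^m Σ_{x ∈ O∩Tⁱ∖Sⁱ} (Δ(x,O_x) − Δ(x, O_x ∪ Sⁱ)). -/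
open Finset

theorem sumsumDiv_nonneg {α : Type*} [DecidableEq α] {d : α → α → ℝ}
    (hdnn : ∀ u v, 0 ≤ d u v) (S : Finset α) : 0 ≤ sumsumDiv d S :=
  div_nonneg (Finset.sum_nonneg fun _ _ => hdnn _ _) zero_le_two

theorem sumsumDiv_mono {α : Type*} [DecidableEq α] {d : α → α → ℝ}
    (hdnn : ∀ u v, 0 ≤ d u v) {S R : Finset α} (h : S ⊆ R) :
    sumsumDiv d S ≤ sumsumDiv d R := by
  unfold sumsumDiv
  have := Finset.sum_le_sum_of_subset_of_nonneg (f := fun p : α × α => d p.1 p.2)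
    (Finset.offDiag_mono h) fun _ _ _ => hdnn _ _
  linarith

theorem notMem_preSet {α : Type*} [DecidableEq α] {k : ℕ} {o : Fin k → α}
    (ho : Function.Injective o) (j : Fin k) : o j ∉ preSet o (j : ℕ) := by
  simp only [preSet, Finset.mem_image, Finset.mem_filter, Finset.mem_univ, true_and, not_exists,
    not_and]
  intro i hi h
  have := ho h
  subst this
  omega

theorem filter_val_lt_succ {k n : ℕ} (hn : n < k) (P : Finset (Fin k)) :
    P.filter (fun j : Fin k => (j : ℕ) < n + 1) =
      if (⟨n, hn⟩ : Fin k) ∈ P then insert ⟨n, hn⟩ (P.filter fun j : Fin k => (j : ℕ) < n)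
      else P.filter fun j : Fin k => (j : ℕ) < n := by
  ext j
  have key : (j : ℕ) = n ↔ j = ⟨n, hn⟩ := by simp [Fin.ext_iff]
  split_ifs with h
  · simp only [Finset.mem_filter, Finset.mem_insert, ← key]
    constructor
    · rintro ⟨h1, h2⟩
      by_cases h3 : (j : ℕ) = n
      · exact Or.inl h3
      · exact Or.inr ⟨h1, by omega⟩
    · rintro (h1 | ⟨h1, h2⟩)
      · exact ⟨(key.1 h1).symm ▸ h, by omega⟩
      · exact ⟨h1, by omega⟩
  · simp only [Finset.mem_filter]
    refine and_congr_right fun h1 => ?_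
    have : (j : ℕ) ≠ n := fun h3 => h (key.1 h3 ▸ h1)
    omega

/-- The marginal gains along a sequence telescope. -/
theorem sum_marginal_preSet_eq {α : Type*} [DecidableEq α] {g : Finset α → ℝ}
    (hg0 : g ∅ = 0) {k : ℕ} (o : Fin k → α) :
    ∑ j, (g (insert (o j) (preSet o (j : ℕ))) - g (preSet o (j : ℕ))) =
      g (Finset.univ.image o) := by
  have key : ∀ n ≤ k, ∑ j ∈ Finset.univ.filter (fun j : Fin k => (j : ℕ) < n),
      (g (insert (o j) (preSet o (j : ℕ))) - g (preSet o (j : ℕ))) = g (preSet o n) := by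
    intro n
    induction n with
    | zero => simp [preSet, hg0]
    | succ n ih =>
      intro hn
      have hs := filter_val_lt_succ (show n < k by omega) Finset.univ
      rw [if_pos (Finset.mem_univ _)] at hs
      have hp : preSet o (n + 1) = insert (o ⟨n, by omega⟩) (preSet o n) := by
        rw [preSet, hs, Finset.image_insert, preSet]
      rw [hs, Finset.sum_insert (by simp), ih (by omega), hp]
      ring
  have := key k le_rfl
  simpa [preSet] using this

/-- For submodular `g`, the marginal gains of the members of a subsequence, taken with respect to
the prefixes of the full sequence, sum to at most the value of the subsequence. -/
theorem sum_marginal_preSet_le {α : Type*} [DecidableEq α] {g : Finset α → ℝ}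
    (hgsub : ∀ A B : Finset α, A ⊆ B → ∀ y ∉ B,
      g (insert y B) - g B ≤ g (insert y A) - g A)
    (hg0 : g ∅ = 0) {k : ℕ} {o : Fin k → α} (ho : Function.Injective o) (P : Finset (Fin k)) :
    ∑ j ∈ P, (g (insert (o j) (preSet o (j : ℕ))) - g (preSet o (j : ℕ))) ≤ g (P.image o) := by
  have key : ∀ n ≤ k, ∑ j ∈ P.filter (fun j : Fin k => (j : ℕ) < n),
      (g (insert (o j) (preSet o (j : ℕ))) - g (preSet o (j : ℕ))) ≤
        g ((P.filter fun j : Fin k => (j : ℕ) < n).image o) := by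
    intro n
    induction n with
    | zero => simp [hg0]
    | succ n ih =>
      intro hn
      have ih := ih (by omega)
      rw [filter_val_lt_succ (show n < k by omega) P]
      split_ifs with h
      · rw [Finset.sum_insert (by simp), Finset.image_insert]
        have := hgsub ((P.filter fun j : Fin k => (j : ℕ) < n).image o) (preSet o n)
          (Finset.image_subset_image (Finset.filter_subset_filter _ (Finset.subset_univ _)))
          _ (notMem_preSet ho ⟨n, by omega⟩)
        dsimp only
        linarith
      · exact ih
  have := key k le_rfl
  simpa using this

/-- Lemma 5: with `T¹, …, Tᵐ` a partition of the finite ground set,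
`Sⁱ ⊆ Tⁱ` a `k`-subset satisfying the 5-niceness bound
`f(Sⁱ ∪ {x}) − f(Sⁱ) ≤ (5/k)·f(Sⁱ)` for every `x ∈ Tⁱ ∖ Sⁱ`,
`O = {o 1, …, o k}` a `k`-subset maximizing `f = g + D` with prefix sets `O_x`, and
`OPT(∪ᵢ Sⁱ)` a `k`-subset of `∪ᵢ Sⁱ` maximizing `f` there:
`g(O) ≤ 6·f(OPT(∪ᵢ Sⁱ)) + ∑ᵢ ∑_{x ∈ O ∩ Tⁱ ∖ Sⁱ} (Δ(x, O_x) − Δ(x, O_x ∪ Sⁱ))`. -/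
theorem stmt15 {α : Type*} [Fintype α] [DecidableEq α]
    (g : Finset α → ℝ)
    (hgnn : ∀ S : Finset α, 0 ≤ g S)
    (hgmono : ∀ A B : Finset α, A ⊆ B → g A ≤ g B)
    (hgsub : ∀ A B : Finset α, A ⊆ B → ∀ y ∉ B,
      g (insert y B) - g B ≤ g (insert y A) - g A)
    (hg0 : g ∅ = 0)
    (d : α → α → ℝ)
    (hd0 : ∀ u, d u u = 0) (hdnn : ∀ u v, 0 ≤ d u v)
    (hdsymm : ∀ u v, d u v = d v u)
    (hdtri : ∀ u v w, d u w ≤ d u v + d v w)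
    (k m : ℕ) (hk : 10 ≤ k)
    (T : Fin m → Finset α)
    (hdisj : ∀ i j, i ≠ j → Disjoint (T i) (T j))
    (hcover : Finset.univ.biUnion T = (Finset.univ : Finset α))
    (S : Fin m → Finset α)
    (hSsub : ∀ i, S i ⊆ T i) (hScard : ∀ i, (S i).card = k)
    (hnice : ∀ i, ∀ x ∈ T i \ S i,
      (g (insert x (S i)) + sumsumDiv d (insert x (S i)))
          - (g (S i) + sumsumDiv d (S i))
        ≤ 5 / (k : ℝ) * (g (S i) + sumsumDiv d (S i)))
    (o : Fin k → α) (ho : Function.Injective o)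
    (hOmax : ∀ R : Finset α, R.card = k →
      g R + sumsumDiv d R
        ≤ g (Finset.univ.image o) + sumsumDiv d (Finset.univ.image o))
    (OPT : Finset α) (hOPTsub : OPT ⊆ Finset.univ.biUnion S) (hOPTcard : OPT.card = k)
    (hOPTmax : ∀ R ⊆ Finset.univ.biUnion S, R.card = k →
      g R + sumsumDiv d R ≤ g OPT + sumsumDiv d OPT) :
    g (Finset.univ.image o)
      ≤ 6 * (g OPT + sumsumDiv d OPT)
        + ∑ i : Fin m,
            ∑ j ∈ Finset.univ.filter (fun j : Fin k => o j ∈ T i ∧ o j ∉ S i),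
              ((g (insert (o j) (preSet o (j : ℕ))) - g (preSet o (j : ℕ)))
                - (g (insert (o j) (preSet o (j : ℕ) ∪ S i))
                    - g (preSet o (j : ℕ) ∪ S i))) := by
  set F := g OPT + sumsumDiv d OPT
  have hk0 : (0 : ℝ) < k := by exact_mod_cast (show 0 < k by omega)
  have hF0 : 0 ≤ F := add_nonneg (hgnn _) (sumsumDiv_nonneg hdnn _)
  set U := Finset.univ.biUnion S with hU
  set N := fun i : Fin m => Finset.univ.filter (fun j : Fin k => o j ∈ T i ∧ o j ∉ S i) with hN
  have hNdisj : ∀ i i', i ≠ i' → Disjoint (N i) (N i') := by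
    intro i i' hi
    refine Finset.disjoint_left.2 fun j hj hj' => ?_
    exact Finset.disjoint_left.1 (hdisj i i' hi) (Finset.mem_filter.1 hj).2.1
      (Finset.mem_filter.1 hj').2.1
  have hNU : Finset.univ.filter (fun j => o j ∉ U) = Finset.univ.biUnion N := by
    ext j
    simp only [hU, hN, Finset.mem_filter, Finset.mem_univ, true_and, Finset.mem_biUnion,
      not_exists]
    constructor
    · intro h
      have hj : o j ∈ Finset.univ.biUnion T := hcover ▸ Finset.mem_univ _
      obtain ⟨i, -, hi⟩ := Finset.mem_biUnion.1 hj
      exact ⟨i, hi, h i⟩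
    · rintro ⟨i, hi, hi'⟩ i' h
      by_cases hii : i = i'
      · exact hi' (hii ▸ h)
      · exact Finset.disjoint_left.1 (hdisj i i' hii) hi (hSsub i' h)
  have hin : ∑ j ∈ Finset.univ.filter (fun j => o j ∈ U),
      (g (insert (o j) (preSet o (j : ℕ))) - g (preSet o (j : ℕ))) ≤ F := by
    refine (sum_marginal_preSet_le hgsub hg0 ho _).trans ?_
    obtain ⟨R, hR1, hR2, hR3⟩ := Finset.exists_subsuperset_card_eq
      (s := (Finset.univ.filter (fun j => o j ∈ U)).image o) (t := U) (n := k)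
      (by
        intro x hx
        obtain ⟨j, hj, rfl⟩ := Finset.mem_image.1 hx
        exact (Finset.mem_filter.1 hj).2)
      (Finset.card_image_le.trans ((Finset.card_le_univ _).trans (by simp)))
      (hOPTcard ▸ Finset.card_le_card hOPTsub)
    linarith [hgmono _ _ hR1, hOPTmax R hR2 hR3, sumsumDiv_nonneg hdnn R]
  have hgain : ∀ i, ∀ j ∈ N i,
      g (insert (o j) (preSet o (j : ℕ) ∪ S i)) - g (preSet o (j : ℕ) ∪ S i) ≤ 5 / (k : ℝ) * F := by
    intro i j hj
    obtain ⟨-, hT, hS⟩ := Finset.mem_filter.1 hj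
    have h1 := hgsub (S i) (preSet o (j : ℕ) ∪ S i) Finset.subset_union_right (o j)
      (by simp [notMem_preSet ho j, hS])
    have h2 := hnice i (o j) (Finset.mem_sdiff.2 ⟨hT, hS⟩)
    have h3 := sumsumDiv_mono hdnn (Finset.subset_insert (o j) (S i))
    have h4 := mul_le_mul_of_nonneg_left
      (hOPTmax (S i) (Finset.subset_biUnion_of_mem S (Finset.mem_univ i)) (hScard i))
      (show 0 ≤ 5 / (k : ℝ) by positivity)
    linarith
  have hout : ∑ i, ∑ j ∈ N i,
      (g (insert (o j) (preSet o (j : ℕ) ∪ S i)) - g (preSet o (j : ℕ) ∪ S i)) ≤ 5 * F := by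
    calc _ ≤ ∑ i, ∑ j ∈ N i, 5 / (k : ℝ) * F :=
          Finset.sum_le_sum fun i _ => Finset.sum_le_sum (hgain i)
      _ = ((Finset.univ.biUnion N).card : ℝ) * (5 / (k : ℝ) * F) := by
          rw [← Finset.sum_biUnion fun i _ i' _ h => hNdisj i i' h, Finset.sum_const,
            nsmul_eq_mul]
      _ ≤ (k : ℝ) * (5 / (k : ℝ) * F) := by
          refine mul_le_mul_of_nonneg_right ?_ (by positivity)
          exact_mod_cast (Finset.card_le_univ _).trans (Fintype.card_fin k).le
      _ = 5 * F := by field_simp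
  have htot := sum_marginal_preSet_eq hg0 o
  rw [← Finset.sum_filter_add_sum_filter_not Finset.univ (fun j => o j ∈ U), hNU,
    Finset.sum_biUnion fun i _ i' _ h => hNdisj i i' h] at htot
  simp only [Finset.sum_sub_distrib] at htot hin hout ⊢
  linarith
end
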